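/- arXiv:1010.4269 — 3 statements merged into one kernel-verified Lean document; each statement's English description precedes it below -/
import Mathlib

section
/- Let T be a finite tree with at least one edge, and let L be the set of its leaves (vertices of degree 1). Then L is not a subset of any minimum vertex cover of T. -/
variable {V : Type*}

/-- `C` is a vertex cover of `G`: every edge has at least one endpoint in `C`. -/
def IsVertexCover (G : SimpleGraph V) (C : Finset V) : Prop :=
  ∀ ⦃u v : V⦄, G.Adj u v → u ∈ C ∨ v ∈ C

/-- `C` is a minimum vertex cover of `G`. -/
def IsMinVertexCover [Fintype V] (G : SimpleGraph V) (C : Finset V) : Prop :=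
  IsVertexCover G C ∧ ∀ D : Finset V, IsVertexCover G D → C.card ≤ D.card

/-- In a graph, the degrees of the vertices outside a vertex cover sum to at most the number of
edges. -/
theorem IsVertexCover.sum_degree_compl_le [Fintype V] [DecidableEq V] {G : SimpleGraph V}
    [DecidableRel G.Adj] {C : Finset V} (hC : IsVertexCover G C) :
    ∑ v ∈ Cᶜ, G.degree v ≤ G.edgeFinset.card := by
  have hdisj : (↑Cᶜ : Set V).PairwiseDisjoint fun v => G.incidenceFinset v := by
    intro u hu v hv huv
    refine Finset.disjoint_left.2 fun e heu hev => ?_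
    rw [SimpleGraph.mem_incidenceFinset] at heu hev
    have hadj := G.adj_of_mem_incidenceSet huv heu hev
    simp only [Finset.coe_compl, Set.mem_compl_iff, Finset.mem_coe] at hu hv
    exact (hC hadj).elim hu hv
  calc ∑ v ∈ Cᶜ, G.degree v = (Cᶜ.biUnion fun v => G.incidenceFinset v).card := by
        simp [Finset.card_biUnion hdisj]
    _ ≤ G.edgeFinset.card :=
        Finset.card_le_card (Finset.biUnion_subset.2 fun v _ => G.incidenceFinset_subset v)

/-- A minimum vertex cover of a bipartite graph contains at most half of the vertices. -/
theorem IsMinVertexCover.two_mul_card_le [Fintype V] {G : SimpleGraph V} {C : Finset V}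
    (hC : IsMinVertexCover G C) (hG : G.Colorable 2) : 2 * C.card ≤ Fintype.card V := by
  classical
  obtain ⟨c⟩ := hG
  have h0 := hC.2 (Finset.univ.filter fun v => c v = 0) fun u v huv => by
    have := c.valid huv
    simp only [Finset.mem_filter, Finset.mem_univ, true_and]
    omega
  have h1 := hC.2 (Finset.univ.filter fun v => ¬ c v = 0) fun u v huv => by
    have := c.valid huv
    simp only [Finset.mem_filter, Finset.mem_univ, true_and]
    omega
  have := Finset.card_filter_add_card_filter_not (s := Finset.univ) fun v => c v = 0
  rw [Finset.card_univ] at this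
  omega

/-- In a finite tree with at least one edge, the set of leaves (vertices of
degree 1) is not contained in any minimum vertex cover. -/
theorem stmt1 [Fintype V] [DecidableEq V] (T : SimpleGraph V) [DecidableRel T.Adj]
    (hT : T.IsTree) (hE : T.edgeSet.Nonempty) (C : Finset V)
    (hC : IsMinVertexCover T C) :
    ¬ (Finset.univ.filter (fun v => T.degree v = 1) ⊆ C) := by
  intro hL
  obtain ⟨e, he⟩ := hE
  have : Nontrivial V := by
    induction e with
    | h u v => exact ⟨u, v, SimpleGraph.Adj.ne he⟩
  have hdeg : ∀ v ∈ Cᶜ, 2 ≤ T.degree v := fun v hv => by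
    have hpos := hT.1.preconnected.degree_pos_of_nontrivial v
    have hne : T.degree v ≠ 1 := fun h => Finset.mem_compl.1 hv (hL (by simpa using h))
    omega
  have hsum := (Finset.card_nsmul_le_sum _ _ 2 hdeg).trans hC.1.sum_degree_compl_le
  have hedge := hT.card_edgeFinset
  have hhalf := hC.two_mul_card_le hT.colorable_two
  rw [smul_eq_mul, Finset.card_compl] at hsum
  omega
end

section
/- Let T = (V,E) be a finite tree on n ≥ 2 vertices. Then the characteristic polynomial of the normalized Laplacian L of T satisfies det(xI − L) = Σ_{M ∈ 𝓜} (−1)^{|E_M|} (x−1)^{n−|V_M|} Π_{v ∈ V_M} (1/deg(v)), where 𝓜 is the set of all matchings of T (including the empty matching), E_M is the edge set and V_M the vertex set of the matching M. -/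
open Polynomial

variable {V : Type*}

/-- The normalized Laplacian of a graph: `L(u,u) = 1`, `L(u,v) = -1/deg u`
when `u ∼ v`, and `0` otherwise. -/
noncomputable def normLap (G : SimpleGraph V) [Fintype V] [DecidableEq V]
    [DecidableRel G.Adj] : Matrix V V ℝ :=
  Matrix.of fun u v =>
    if u = v then 1 else if G.Adj u v then -(1 / (G.degree u : ℝ)) else 0

/-- The matchings of `G`: the sets of pairwise disjoint edges of `G`
(including the empty matching). -/
def matchings (G : SimpleGraph V) [Fintype V] [DecidableEq V] [DecidableRel G.Adj] :
    Finset (Finset (Sym2 V)) :=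
  G.edgeFinset.powerset.filter fun M =>
    ∀ e ∈ M, ∀ f ∈ M, e ≠ f → ∀ v : V, ¬(v ∈ e ∧ v ∈ f)

/-- `V_M`: the set of vertices incident to some edge of the matching `M`. -/
def matchVerts [Fintype V] [DecidableEq V] (M : Finset (Sym2 V)) : Finset V :=
  Finset.univ.filter fun v => ∃ e ∈ M, v ∈ e

open Equiv

/-- A permutation of the vertices of a forest that moves every vertex to itself or to a neighbour
is an involution. -/
lemma SimpleGraph.IsAcyclic.perm_apply_apply [Finite V] {G : SimpleGraph V} (hG : G.IsAcyclic)
    {σ : Perm V} (hσ : ∀ v, σ v ≠ v → G.Adj v (σ v)) (v : V) : σ (σ v) = v := by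
  by_contra hne
  have hv : σ v ≠ v := fun h => hne (by rw [h, h])
  have hbridge : ¬ (G.deleteEdges {s(v, σ v)}).Reachable (σ v) v := fun h =>
    (SimpleGraph.isBridge_iff.1
      (SimpleGraph.isAcyclic_iff_forall_isBridge.1 hG (hσ v hv))) h.symm
  have hstep : ∀ w, (G.deleteEdges {s(v, σ v)}).Reachable (σ v) w →
      (G.deleteEdges {s(v, σ v)}).Reachable (σ v) (σ w) := by
    intro w hw
    by_cases hfix : σ w = w
    · rwa [hfix]
    · refine hw.trans (SimpleGraph.Adj.reachable ?_)
      rw [SimpleGraph.deleteEdges_adj]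
      refine ⟨hσ w hfix, fun h => ?_⟩
      rcases Sym2.eq_iff.1 (Set.mem_singleton_iff.1 h) with ⟨rfl, -⟩ | ⟨rfl, h'⟩
      · exact hbridge hw
      · exact hne h'
  have hpow : ∀ k : ℕ, (G.deleteEdges {s(v, σ v)}).Reachable (σ v) ((σ ^ k) (σ v)) := by
    intro k
    induction k with
    | zero => simp
    | succ k ih =>
      rw [pow_succ', Perm.mul_apply]
      exact hstep _ ih
  refine hbridge ?_
  have hlast := hpow (orderOf σ - 1)
  rwa [← Perm.mul_apply, ← pow_succ, Nat.sub_add_cancel (orderOf_pos σ), pow_orderOf_eq_one,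
    Perm.one_apply] at hlast

/-- The permutation `σ` exchanges the endpoints of every edge of `M` and fixes all other
vertices. -/
def IsSwapAlong (M : Finset (Sym2 V)) (σ : Perm V) : Prop :=
  ∀ v w, s(v, w) ∈ M ↔ σ v ≠ v ∧ σ v = w

lemma exists_isSwapAlong [Fintype V] [DecidableEq V] (M : Finset (Sym2 V))
    (hdiag : ∀ e ∈ M, ¬ e.IsDiag)
    (hdisj : ∀ e ∈ M, ∀ f ∈ M, e ≠ f → ∀ v : V, ¬(v ∈ e ∧ v ∈ f)) :
    ∃ σ : Perm V, IsSwapAlong M σ ∧ Perm.sign σ = (-1) ^ M.card := by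
  induction M using Finset.induction_on with
  | empty => exact ⟨1, by simp [IsSwapAlong], by simp⟩
  | insert e M he ih =>
    obtain ⟨σ, hσ, hsign⟩ := ih (fun f hf => hdiag f (Finset.mem_insert_of_mem hf))
      (fun f hf g hg => hdisj f (Finset.mem_insert_of_mem hf) g (Finset.mem_insert_of_mem hg))
    induction e using Sym2.ind with
    | _ a b =>
    have hab : a ≠ b := by simpa using hdiag s(a, b) (Finset.mem_insert_self _ _)
    have hfix : ∀ c ∈ s(a, b), σ c = c := by
      intro c hc
      by_contra hne
      have hmem := (hσ c (σ c)).2 ⟨hne, rfl⟩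
      exact hdisj _ (Finset.mem_insert_self _ _) _ (Finset.mem_insert_of_mem hmem)
        (fun h => he (h ▸ hmem)) c ⟨hc, Sym2.mem_mk_left _ _⟩
    have ha : σ a = a := hfix a (by simp)
    have hb : σ b = b := hfix b (by simp)
    refine ⟨σ * swap a b, fun v w => ?_, ?_⟩
    · have h := hσ v w
      rw [Finset.mem_insert, Perm.mul_apply]
      by_cases hva : v = a
      · subst hva
        simp only [ha, ne_eq, not_true_eq_false, false_and, iff_false] at h
        simp [h, hb, hab.symm, eq_comm]
      · by_cases hvb : v = b
        · subst hvb
          simp only [hb, ne_eq, not_true_eq_false, false_and, iff_false] at h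
          simp [h, ha, hab, eq_comm]
        · rw [swap_apply_of_ne_of_ne hva hvb, h]
          simp [hva, hvb]
    · rw [Perm.sign_mul, Perm.sign_swap hab, hsign, Finset.card_insert_of_notMem he, pow_succ]

lemma IsSwapAlong.mem_matchVerts_iff [Fintype V] [DecidableEq V] {M : Finset (Sym2 V)}
    {σ : Perm V} (h : IsSwapAlong M σ) (v : V) : v ∈ matchVerts M ↔ σ v ≠ v := by
  simp only [matchVerts, Finset.mem_filter, Finset.mem_univ, true_and]
  constructor
  · rintro ⟨e, he, w, rfl⟩
    exact ((h v w).1 he).1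
  · exact fun hv => ⟨_, (h v _).2 ⟨hv, rfl⟩, Sym2.mem_mk_left _ _⟩

lemma IsSwapAlong.left_unique {M N : Finset (Sym2 V)} {σ : Perm V} (hM : IsSwapAlong M σ)
    (hN : IsSwapAlong N σ) : M = N := by
  ext e
  induction e using Sym2.ind with
  | _ v w => rw [hM, hN]

lemma IsSwapAlong.right_unique {M : Finset (Sym2 V)} {σ τ : Perm V} (hσ : IsSwapAlong M σ)
    (hτ : IsSwapAlong M τ) : σ = τ := by
  ext v
  by_cases h : σ v = v
  · by_contra hne
    exact ((hσ v (τ v)).1 ((hτ v (τ v)).2 ⟨fun h' => hne (h.trans h'.symm), rfl⟩)).1 h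
  · exact ((hτ v (σ v)).1 ((hσ v (σ v)).2 ⟨h, rfl⟩)).2.symm

lemma exists_isSwapAlong_of_involutive [Fintype V] [DecidableEq V] {G : SimpleGraph V}
    [DecidableRel G.Adj] {σ : Perm V} (hinv : ∀ v, σ (σ v) = v)
    (hσ : ∀ v, σ v ≠ v → G.Adj v (σ v)) : ∃ M ∈ matchings G, IsSwapAlong M σ := by
  have hM : IsSwapAlong (σ.support.image fun v => s(v, σ v)) σ := by
    intro v w
    simp only [Finset.mem_image, Perm.mem_support, Sym2.eq_iff]
    constructor
    · rintro ⟨u, hu, ⟨rfl, rfl⟩ | ⟨rfl, rfl⟩⟩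
      · exact ⟨hu, rfl⟩
      · exact ⟨fun h => hu (σ.injective h), hinv _⟩
    · rintro ⟨hv, rfl⟩
      exact ⟨v, hv, Or.inl ⟨rfl, rfl⟩⟩
  refine ⟨_, Finset.mem_filter.2 ⟨Finset.mem_powerset.2 fun e he => ?_, ?_⟩, hM⟩
  · obtain ⟨v, hv, rfl⟩ := Finset.mem_image.1 he
    exact SimpleGraph.mem_edgeFinset.2 (hσ v (Perm.mem_support.1 hv))
  · rintro e he f hf hne v ⟨⟨w, rfl⟩, ⟨u, rfl⟩⟩
    exact hne (by rw [← ((hM v w).1 he).2, ← ((hM v u).1 hf).2])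

lemma charmatrix_normLap_apply [Fintype V] [DecidableEq V] (G : SimpleGraph V)
    [DecidableRel G.Adj] (u v : V) :
    (normLap G).charmatrix u v =
      if u = v then X - 1 else if G.Adj u v then C (1 / (G.degree u : ℝ)) else 0 := by
  split_ifs with h h'
  · subst h
    simp [Matrix.charmatrix_apply_eq, normLap]
  · simp [normLap, h, h']
  · simp [normLap, h, h']

lemma prod_charmatrix_normLap [Fintype V] [DecidableEq V] (G : SimpleGraph V)
    [DecidableRel G.Adj] {M : Finset (Sym2 V)} (hM : M ∈ matchings G) {σ : Perm V}
    (hσ : IsSwapAlong M σ) :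
    ∏ v, (normLap G).charmatrix v (σ v) =
      C (∏ v ∈ matchVerts M, (1 / (G.degree v : ℝ))) *
        (X - 1) ^ (Fintype.card V - (matchVerts M).card) := by
  rw [← Finset.prod_mul_prod_compl (matchVerts M), map_prod, ← Finset.card_compl,
    ← Finset.prod_const]
  congr 1
  · refine Finset.prod_congr rfl fun v hv => ?_
    have hne := (hσ.mem_matchVerts_iff v).1 hv
    have hadj : G.Adj v (σ v) := SimpleGraph.mem_edgeFinset.1
      (Finset.mem_powerset.1 (Finset.mem_filter.1 hM).1 ((hσ v _).2 ⟨hne, rfl⟩))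
    rw [charmatrix_normLap_apply, if_neg hne.symm, if_pos hadj]
  · refine Finset.prod_congr rfl fun v hv => ?_
    have hfix : σ v = v := by
      by_contra hne
      exact Finset.mem_compl.1 hv ((hσ.mem_matchVerts_iff v).2 hne)
    rw [charmatrix_normLap_apply, if_pos hfix.symm]

/-- For a tree `T` on `n ≥ 2` vertices, the characteristic polynomial `det(xI − L)`
of the normalized Laplacian equals
`Σ_{M matching} (−1)^{|E_M|} (x−1)^{n−|V_M|} Π_{v ∈ V_M} 1/deg v`. -/
theorem stmt4 [Fintype V] [DecidableEq V] (T : SimpleGraph V) [DecidableRel T.Adj]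
    (hT : T.IsTree) (hn : 2 ≤ Fintype.card V) :
    (normLap T).charpoly =
      ∑ M ∈ matchings T,
        Polynomial.C ((-1 : ℝ) ^ M.card * ∏ v ∈ matchVerts M, (1 / (T.degree v : ℝ))) *
          (Polynomial.X - 1) ^ (Fintype.card V - (matchVerts M).card) := by
  have hex : ∀ M ∈ matchings T, ∃ σ : Perm V,
      IsSwapAlong M σ ∧ Perm.sign σ = (-1) ^ M.card := fun M hM =>
    exists_isSwapAlong M
      (fun e he => T.not_isDiag_of_mem_edgeFinset
        (Finset.mem_powerset.1 (Finset.mem_filter.1 hM).1 he))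
      (Finset.mem_filter.1 hM).2
  choose! τ hτ hsign using hex
  rw [Matrix.charpoly, ← Matrix.det_transpose, Matrix.det_apply']
  simp only [Matrix.transpose_apply]
  symm
  refine Finset.sum_of_injOn τ ?_ (fun M _ => Finset.mem_univ _) ?_ ?_
  · intro M hM N hN h
    exact (hτ M hM).left_unique (h ▸ hτ N hN)
  · intro σ _ hσ
    by_cases hadj : ∀ v, σ v ≠ v → T.Adj v (σ v)
    · obtain ⟨M, hM, hMσ⟩ := exists_isSwapAlong_of_involutive
        (hT.isAcyclic.perm_apply_apply hadj) hadj
      exact absurd ⟨M, hM, (hτ M hM).right_unique hMσ⟩ hσ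
    · push Not at hadj
      obtain ⟨v, hv, hnadj⟩ := hadj
      rw [Finset.prod_eq_zero (Finset.mem_univ v), mul_zero]
      rw [charmatrix_normLap_apply, if_neg hv.symm, if_neg hnadj]
  · intro M hM
    rw [prod_charmatrix_normLap T hM (hτ M hM), hsign M hM, C_mul, mul_assoc]
    simp
end

section
/- Let T = (V,E) be a finite tree on n ≥ 2 vertices with normalized Laplacian L, let C be a minimum vertex cover of T, and let f : V → ℝ be any eigenvector of L with eigenvalue 1 (i.e. Lf = f). Then f(c) = 0 for every c ∈ C. In other words, every 1-eigenvector vanishes on every minimum vertex cover of T. -/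
variable {V : Type*}

/-- In a tree, a vertex has at most one neighbour that is closer to a given root. -/
theorem SimpleGraph.IsTree.eq_of_adj_of_dist_eq {G : SimpleGraph V} (hG : G.IsTree)
    {r a b w : V} (ha : G.Adj a w) (hb : G.Adj b w)
    (hda : G.dist r w = G.dist r a + 1) (hdb : G.dist r w = G.dist r b + 1) : a = b := by
  obtain ⟨p, hp⟩ := hG.connected.exists_walk_length_eq_dist r a
  obtain ⟨q, hq⟩ := hG.connected.exists_walk_length_eq_dist r b
  have hpath : p.concat ha = q.concat hb :=
    (hG.existsUnique_path r w).unique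
      ((p.concat ha).isPath_of_length_eq_dist (by rw [SimpleGraph.Walk.length_concat]; omega))
      ((q.concat hb).isPath_of_length_eq_dist (by rw [SimpleGraph.Walk.length_concat]; omega))
  exact (SimpleGraph.Walk.concat_inj hpath).1

/-- A function fixed by the normalized Laplacian sums to zero over every neighbourhood. -/
theorem sum_neighborFinset_eq_zero_of_normLap_mulVec_eq [Fintype V] [DecidableEq V]
    (G : SimpleGraph V) [DecidableRel G.Adj] {f : V → ℝ} (hf : (normLap G).mulVec f = f) (u : V) :
    ∑ v ∈ G.neighborFinset u, f v = 0 := by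
  rcases (G.neighborFinset u).eq_empty_or_nonempty with h | h
  · simp [h]
  have hdeg : (G.degree u : ℝ) ≠ 0 := by
    rw [← G.card_neighborFinset_eq_degree]
    exact_mod_cast h.card_pos.ne'
  have hsplit : ∀ v, normLap G u v * f v =
      (if u = v then f v else 0) + -(1 / (G.degree u : ℝ)) * (if G.Adj u v then f v else 0) := by
    intro v
    by_cases huv : u = v
    · subst huv; simp [normLap]
    · by_cases hadj : G.Adj u v <;> simp [normLap, huv, hadj]
  have hu : ∑ v, normLap G u v * f v = f u := congrFun hf u
  simp_rw [hsplit, Finset.sum_add_distrib, ← Finset.mul_sum] at hu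
  rw [Finset.sum_ite_eq, if_pos (Finset.mem_univ u), ← Finset.sum_filter,
    ← G.neighborFinset_eq_filter] at hu
  have hmul : -(1 / (G.degree u : ℝ)) * ∑ v ∈ G.neighborFinset u, f v = 0 := by linarith
  exact (mul_eq_zero.mp hmul).resolve_left (neg_ne_zero.mpr (one_div_ne_zero hdeg))

/-- In a tree, let `S` be a set of vertices containing the root `r`, and let `N` be a set of
vertices each of which has two distinct neighbours in `S`. Then `N` is smaller than `S`. -/
theorem SimpleGraph.IsTree.card_lt_card_of_two_neighbors [DecidableEq V] {G : SimpleGraph V}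
    (hG : G.IsTree) {r : V} {S N : Finset V} (hr : r ∈ S)
    (hN : ∀ i ∈ N, ∃ a ∈ S, ∃ b ∈ S, a ≠ b ∧ G.Adj i a ∧ G.Adj i b) : N.card < S.card := by
  have hchild : ∀ i ∈ N, ∃ c ∈ S, G.Adj i c ∧ G.dist r c = G.dist r i + 1 := by
    intro i hi
    obtain ⟨a, haS, b, hbS, hab, ha, hb⟩ := hN i hi
    rcases hG.dist_eq_dist_add_one_of_adj r ha with hda | hda
    · rcases hG.dist_eq_dist_add_one_of_adj r hb with hdb | hdb
      · exact absurd (hG.eq_of_adj_of_dist_eq ha.symm hb.symm hda hdb) hab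
      · exact ⟨b, hbS, hb, hdb⟩
    · exact ⟨a, haS, ha, hda⟩
  choose! g hgS hadj hdist using hchild
  have hle : N.card ≤ (S.erase r).card := by
    refine Finset.card_le_card_of_injOn g (fun i hi => ?_) fun i hi j hj hij => ?_
    · refine Finset.mem_coe.mpr (Finset.mem_erase.mpr ⟨fun h => ?_, hgS i hi⟩)
      have := hdist i hi
      rw [h, SimpleGraph.dist_self] at this
      omega
    · have hj' := hadj j hj
      have hd := hdist j hj
      rw [← hij] at hj' hd
      exact hG.eq_of_adj_of_dist_eq (hadj i hi) hj' (hdist i hi) hd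
  exact hle.trans_lt (Finset.card_erase_lt_of_mem hr)

/-- On a tree with `n ≥ 2` vertices, any eigenvector of the normalized Laplacian
with eigenvalue `1` (i.e. any `f` with `Lf = f`) vanishes on every minimum
vertex cover. -/
theorem stmt9 [Fintype V] [DecidableEq V] (T : SimpleGraph V) [DecidableRel T.Adj]
    (hT : T.IsTree) (hn : 2 ≤ Fintype.card V) (C : Finset V)
    (hC : IsMinVertexCover T C) (f : V → ℝ) (hf : (normLap T).mulVec f = f) :
    ∀ c ∈ C, f c = 0 := by
  classical
  intro r hrC
  by_contra hr
  obtain ⟨hcov, hmin⟩ := hC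
  let S : Finset V := {c ∈ C | f c ≠ 0 ∧ Even (T.dist r c)}
  let N : Finset V := {i | i ∉ C ∧ ∃ a ∈ S, T.Adj i a}
  have hSC : S ⊆ C := Finset.filter_subset _ _
  have heven : ∀ {u v}, T.Adj u v → (Even (T.dist r u) ↔ ¬ Even (T.dist r v)) := by
    intro u v huv
    rcases hT.dist_eq_dist_add_one_of_adj r huv with h | h <;> simp [h, Nat.even_add_one]
  have hrS : r ∈ S := by simp [S, hrC, hr]
  have hlt : N.card < S.card := by
    refine hT.card_lt_card_of_two_neighbors hrS fun i hi => ?_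
    obtain ⟨hiC, a, haS, hia⟩ := (Finset.mem_filter.mp hi).2
    obtain ⟨-, hfa, hea⟩ := Finset.mem_filter.mp haS
    obtain ⟨b, hb, hba, hfb⟩ : ∃ b ∈ T.neighborFinset i, b ≠ a ∧ f b ≠ 0 := by
      by_contra! hall
      exact hfa (by
        rw [← sum_neighborFinset_eq_zero_of_normLap_mulVec_eq T hf i,
          Finset.sum_eq_single_of_mem a (by simpa using hia) hall])
    have hib : T.Adj i b := by simpa using hb
    refine ⟨a, haS, b, Finset.mem_filter.mpr ⟨(hcov hib).resolve_left hiC, hfb, ?_⟩,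
      hba.symm, hia, hib⟩
    have h1 := heven hia
    have h2 := heven hib
    tauto
  have hside : ∀ {u v}, T.Adj u v → u ∈ C → u ∈ (C \ S) ∪ N ∨ v ∈ (C \ S) ∪ N := by
    intro u v huv hu
    by_cases huS : u ∈ S
    · right
      by_cases hvC : v ∈ C
      · refine Finset.mem_union_left _ (Finset.mem_sdiff.mpr ⟨hvC, fun hvS => ?_⟩)
        exact (heven huv).mp (Finset.mem_filter.mp huS).2.2 (Finset.mem_filter.mp hvS).2.2
      · exact Finset.mem_union_right _
          (Finset.mem_filter.mpr ⟨Finset.mem_univ v, hvC, u, huS, huv.symm⟩)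
    · exact Or.inl (Finset.mem_union_left _ (Finset.mem_sdiff.mpr ⟨hu, huS⟩))
  have hle := hmin ((C \ S) ∪ N) fun u v huv =>
    (hcov huv).elim (hside huv) fun hv => (hside huv.symm hv).symm
  have hunion := Finset.card_union_le (C \ S) N
  have hsdiff := Finset.card_sdiff_add_card_eq_card hSC
  omega
end
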